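/- For s ∈ (0,1) and γ > 0 let b = b(s,γ) ∈ (s,1) be the unique solution of K(s,b) = γ. Then: (i) b − s ≤ s·H^{−1}(γ/s); (ii) s·(1−s)·H̃^{−1}(γ/(1−s)) ≤ b − s ≤ (1−s)·H̃^{−1}(γ/(1−s)); (iii) for every ε > 0 there is δ > 0 such that for all s ∈ (0,1) and γ > 0 with γ/(s(1−s)) ≤ δ one has | (b(s,γ) − s)/√(2γ·s(1−s)) − 1 | ≤ ε. -/

import Mathlib

open Set

/-- K(s,t) = s log(s/t) + (1−s) log((1−s)/(1−t)), with the convention 0·log 0 = 0. -/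
noncomputable def Kfun (s t : ℝ) : ℝ :=
  s * Real.log (s / t) + (1 - s) * Real.log ((1 - s) / (1 - t))

/-- H(x) = x − log(1+x). -/
noncomputable def Hfun (x : ℝ) : ℝ := x - Real.log (1 + x)

/-- H̃(z) = −log(1−z) − z. -/
noncomputable def Htfun (z : ℝ) : ℝ := -Real.log (1 - z) - z

theorem Hfun_strictMonoOn : StrictMonoOn Hfun (Ici 0) := by
  intro x hx y _ hxy
  have hx0 : (0 : ℝ) ≤ x := hx
  have hpos : 0 < (1 + y) / (1 + x) := div_pos (by linarith) (by linarith)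
  have hne : (1 + y) / (1 + x) ≠ 1 := by
    rw [Ne, div_eq_one_iff_eq (by linarith)]
    linarith
  have hlog := Real.log_lt_sub_one_of_pos hpos hne
  rw [Real.log_div (by linarith) (by linarith)] at hlog
  have hle : (1 + y) / (1 + x) - 1 ≤ y - x := by
    rw [tsub_le_iff_right, div_le_iff₀ (by linarith)]
    nlinarith
  unfold Hfun
  linarith

theorem Htfun_strictMonoOn : StrictMonoOn Htfun (Ico 0 1) := by
  intro x hx y hy hxy
  have hx0 := hx.1
  have hy1 := hy.2
  have hpos : 0 < (1 - y) / (1 - x) := div_pos (by linarith) (by linarith)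
  have hne : (1 - y) / (1 - x) ≠ 1 := by
    rw [Ne, div_eq_one_iff_eq (by linarith)]
    linarith
  have hlog := Real.log_lt_sub_one_of_pos hpos hne
  rw [Real.log_div (by linarith) (by linarith)] at hlog
  have hle : (1 - y) / (1 - x) - 1 ≤ x - y := by
    rw [tsub_le_iff_right, div_le_iff₀ (by linarith)]
    nlinarith
  unfold Htfun
  linarith

theorem Kfun_add_eq {s x : ℝ} (hs : 0 < s) (hx : 0 ≤ x) (hxs : x < 1 - s) :
    Kfun s (s + x) = -s * Real.log (1 + x / s) - (1 - s) * Real.log (1 - x / (1 - s)) := by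
  have h1 : 1 + x / s = (s / (s + x))⁻¹ := by
    field_simp
  have h2 : 1 - x / (1 - s) = ((1 - s) / (1 - (s + x)))⁻¹ := by
    rw [inv_div, eq_div_iff (by linarith), sub_mul, div_mul_cancel₀ _ (by linarith)]
    ring
  rw [h1, h2, Real.log_inv, Real.log_inv, Kfun]
  ring

theorem mul_Hfun_le_Kfun {s x : ℝ} (hs : 0 < s) (hx : 0 ≤ x) (hxs : x < 1 - s) :
    s * Hfun (x / s) ≤ Kfun s (s + x) := by
  rw [Kfun_add_eq hs hx hxs, Hfun, mul_sub, mul_div_cancel₀ _ hs.ne']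
  have hs1 : 0 < 1 - s := by linarith
  have h := Real.log_le_sub_one_of_pos (sub_pos.2 ((div_lt_one hs1).2 hxs))
  have h' := mul_le_mul_of_nonneg_left h hs1.le
  have he : (1 - s) * (1 - x / (1 - s) - 1) = -x := by
    field_simp
    ring
  linarith

theorem mul_Htfun_le_Kfun {s x : ℝ} (hs : 0 < s) (hx : 0 ≤ x) (hxs : x < 1 - s) :
    (1 - s) * Htfun (x / (1 - s)) ≤ Kfun s (s + x) := by
  have hs1 : 0 < 1 - s := by linarith
  rw [Kfun_add_eq hs hx hxs, Htfun, mul_sub, mul_div_cancel₀ _ hs1.ne']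
  have h := Real.log_le_sub_one_of_pos (x := 1 + x / s) (by positivity)
  have h' := mul_le_mul_of_nonneg_left h hs.le
  have he : s * (1 + x / s - 1) = x := by
    field_simp
    ring
  linarith

theorem hasDerivAt_Kfun_add {s t : ℝ} (hs : 0 < s) (ht : 0 ≤ t) (hts : t < 1 - s) :
    HasDerivAt (fun t => Kfun s (s + t)) (t / ((s + t) * (1 - s - t))) t := by
  have hs1 : 1 - s ≠ 0 := by linarith
  have hst : s + t ≠ 0 := by linarith
  have hst1 : 1 - (s + t) ≠ 0 := by linarith
  have hst2 : 1 - s - t ≠ 0 := by linarith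
  have hadd : HasDerivAt (fun t => s + t) 1 t := (hasDerivAt_id t).const_add s
  have h1 : HasDerivAt (fun t => s / (s + t)) (-s / (s + t) ^ 2) t := by
    exact ((hasDerivAt_const t s).fun_div hadd hst).congr_deriv (by ring)
  have h2 : HasDerivAt (fun t => (1 - s) / (1 - (s + t))) ((1 - s) / (1 - (s + t)) ^ 2) t := by
    exact ((hasDerivAt_const t (1 - s)).fun_div (hadd.const_sub 1) hst1).congr_deriv (by ring)
  have h := ((h1.log (div_ne_zero hs.ne' hst)).const_mul s).fun_add
    ((h2.log (div_ne_zero hs1 hst1)).const_mul (1 - s))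
  refine h.congr_deriv ?_
  rw [show 1 - (s + t) = 1 - s - t by ring]
  field_simp
  ring

theorem Kfun_self (s : ℝ) : Kfun s s = 0 := by
  have h (x : ℝ) : Real.log (x / x) = 0 := by
    rcases eq_or_ne x 0 with rfl | hx <;> simp [*]
  simp [Kfun, h]

theorem nonneg_of_hasDerivAt_nonneg {F F' : ℝ → ℝ} {x : ℝ} (hx : 0 ≤ x) (h0 : F 0 = 0)
    (hF : ∀ t ∈ Icc 0 x, HasDerivAt F (F' t) t) (hF' : ∀ t ∈ Icc 0 x, 0 ≤ F' t) : 0 ≤ F x := by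
  have hmono : MonotoneOn F (Icc 0 x) :=
    monotoneOn_of_hasDerivWithinAt_nonneg (convex_Icc 0 x)
      (fun t ht => (hF t ht).continuousAt.continuousWithinAt)
      (fun t ht => (hF t (interior_subset ht)).hasDerivWithinAt)
      (fun t ht => hF' t (interior_subset ht))
  simpa [h0] using hmono (left_mem_Icc.2 hx) (right_mem_Icc.2 hx) hx

theorem sq_le_mul_Kfun {s x : ℝ} (hs : 0 < s) (hx : 0 ≤ x) (hxs : x < 1 - s) :
    x ^ 2 ≤ 2 * (s * (1 - s) + x) * Kfun s (s + x) := by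
  have h := nonneg_of_hasDerivAt_nonneg hx
    (F := fun t => 2 * (s * (1 - s) + x) * Kfun s (s + t) - t ^ 2)
    (F' := fun t => 2 * (s * (1 - s) + x) * (t / ((s + t) * (1 - s - t))) - 2 * t)
    (by simp [Kfun_self])
    (fun t ht => by
      simpa using ((hasDerivAt_Kfun_add hs ht.1 (ht.2.trans_lt hxs)).const_mul
        (2 * (s * (1 - s) + x))).fun_sub (hasDerivAt_pow 2 t))
    (fun t ht => by
      have hd : 0 < (s + t) * (1 - s - t) :=
        mul_pos (by linarith [ht.1]) (by linarith [ht.2])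
      rw [sub_nonneg, mul_div_assoc', le_div_iff₀ hd]
      have : (s + t) * (1 - s - t) ≤ s * (1 - s) + x := by nlinarith [ht.1, ht.2]
      nlinarith [mul_le_mul_of_nonneg_left this ht.1])
  exact sub_nonneg.1 h

theorem mul_Kfun_le_sq {s x : ℝ} (hs : 0 < s) (hx : 0 ≤ x) (hxs : x < 1 - s) :
    2 * (s * (1 - s) - x) * Kfun s (s + x) ≤ x ^ 2 := by
  have h := nonneg_of_hasDerivAt_nonneg hx
    (F := fun t => t ^ 2 - 2 * (s * (1 - s) - x) * Kfun s (s + t))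
    (F' := fun t => 2 * t - 2 * (s * (1 - s) - x) * (t / ((s + t) * (1 - s - t))))
    (by simp [Kfun_self])
    (fun t ht => by
      simpa using (hasDerivAt_pow 2 t).fun_sub
        ((hasDerivAt_Kfun_add hs ht.1 (ht.2.trans_lt hxs)).const_mul (2 * (s * (1 - s) - x))))
    (fun t ht => by
      have hd : 0 < (s + t) * (1 - s - t) :=
        mul_pos (by linarith [ht.1]) (by linarith [ht.2])
      rw [sub_nonneg, mul_div_assoc', div_le_iff₀ hd]
      have : s * (1 - s) - x ≤ (s + t) * (1 - s - t) := by nlinarith [ht.1, ht.2]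
      nlinarith [mul_le_mul_of_nonneg_left this ht.1])
  exact sub_nonneg.1 h

theorem hasDerivAt_Htfun {y : ℝ} (hy : y < 1) : HasDerivAt Htfun (y / (1 - y)) y := by
  have hy1 : 1 - y ≠ 0 := by linarith
  have h := ((((hasDerivAt_id y).const_sub 1).log hy1).fun_neg).fun_sub (hasDerivAt_id y)
  refine h.congr_deriv ?_
  simp only [id]
  field_simp
  ring

theorem Kfun_le_mul_Htfun {s y : ℝ} (hs : 0 < s) (hs1 : s < 1) (hy : 0 ≤ y) (hy1 : y < 1) :
    Kfun s (s + s * (1 - s) * y) ≤ (1 - s) * Htfun y := by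
  have hs' : 0 < 1 - s := by linarith
  have h := nonneg_of_hasDerivAt_nonneg hy
    (F := fun t => (1 - s) * Htfun t - Kfun s (s + s * (1 - s) * t))
    (F' := fun t => (1 - s) * (t / (1 - t)) - s * (1 - s) * t /
      ((s + s * (1 - s) * t) * (1 - s - s * (1 - s) * t)) * (s * (1 - s)))
    (by simp [Kfun_self, Htfun])
    (fun t ht => by
      have ht1 := ht.2.trans_lt hy1
      have hst : s * t < 1 := by nlinarith [ht.1]
      have hK := hasDerivAt_Kfun_add hs (t := s * (1 - s) * t)
        (mul_nonneg (mul_pos hs hs').le ht.1) (by nlinarith)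
      have hlin : HasDerivAt (fun t => s * (1 - s) * t) (s * (1 - s)) t := by
        simpa using (hasDerivAt_id t).const_mul (s * (1 - s))
      exact ((hasDerivAt_Htfun ht1).const_mul (1 - s)).fun_sub (hK.comp t hlin))
    (fun t ht => by
      have ht0 := ht.1
      have ht1 : 0 < 1 - t := by linarith [ht.2]
      have hst : 0 < 1 - s * t := by nlinarith
      have hA : 0 < 1 + (1 - s) * t := by positivity
      have he : s * (1 - s) * t / ((s + s * (1 - s) * t) * (1 - s - s * (1 - s) * t))
          * (s * (1 - s)) = (1 - s) * (s * t / ((1 + (1 - s) * t) * (1 - s * t))) := by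
        rw [show s + s * (1 - s) * t = s * (1 + (1 - s) * t) by ring,
          show 1 - s - s * (1 - s) * t = (1 - s) * (1 - s * t) by ring]
        field_simp
      rw [he, ← mul_sub]
      refine mul_nonneg hs'.le (sub_nonneg.2 (div_le_div₀ ht0 (by nlinarith) ht1 ?_))
      nlinarith [mul_nonneg (mul_nonneg hs'.le ht0) hst.le])
  exact sub_nonneg.1 h

theorem abs_div_sqrt_sub_one_le {v g x : ℝ} (hv : 0 < v) (hg : 0 < g) (hx : 0 ≤ x)
    (hlo : 2 * (v - x) * g ≤ x ^ 2) (hup : x ^ 2 ≤ 2 * (v + x) * g) :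
    |x / Real.sqrt (2 * g * v) - 1| ≤ x / v := by
  set r := x / Real.sqrt (2 * g * v) with hr
  have hr0 : 0 ≤ r := by positivity
  have hr2 : r ^ 2 = x ^ 2 / (2 * g * v) := by
    rw [hr, div_pow, Real.sq_sqrt (by positivity)]
  have h1 : r ^ 2 ≤ 1 + x / v := by
    rw [hr2, div_le_iff₀ (by positivity)]
    have : (1 + x / v) * (2 * g * v) = 2 * (v + x) * g := by field_simp
    linarith
  have h2 : 1 - x / v ≤ r ^ 2 := by
    rw [hr2, le_div_iff₀ (by positivity)]
    have : (1 - x / v) * (2 * g * v) = 2 * (v - x) * g := by field_simp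
    linarith
  have hy : 0 ≤ x / v := by positivity
  rw [abs_le]
  constructor
  · by_contra! h
    nlinarith
  · by_contra! h
    nlinarith

theorem div_le_of_sq_le {v g x ε : ℝ} (hv : 0 < v) (hx : 0 ≤ x) (hε : 0 < ε)
    (hup : x ^ 2 ≤ 2 * (v + x) * g) (hg : g / v ≤ ε ^ 2 / (2 * (1 + ε))) : x / v ≤ ε := by
  rw [div_le_div_iff₀ hv (by positivity)] at hg
  rw [div_le_iff₀ hv]
  by_contra! h
  have h1 : x ^ 2 * (1 + ε) ≤ (v + x) * (ε ^ 2 * v) := by nlinarith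
  nlinarith [mul_pos (mul_pos hε hv) (sub_pos.2 h), mul_pos hε hv,
    mul_nonneg (mul_nonneg hε.le hx) (sub_pos.2 h).le]

/-- Property (K.6) of Dümbgen–Wellner: for `s ∈ (0,1)` and `γ > 0` let `b = b(s,γ) ∈ (s,1)`
be the unique solution of `K(s,b) = γ`, and let `H⁻¹ : [0,∞) → [0,∞)`, `H̃⁻¹ : [0,∞) → [0,1)`
be the inverses of `H`, `H̃`.  Then:
(i) `b − s ≤ s H⁻¹(γ/s)`;
(ii) `s(1−s) H̃⁻¹(γ/(1−s)) ≤ b − s ≤ (1−s) H̃⁻¹(γ/(1−s))`;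
(iii) `(b(s,γ) − s)/√(2γ s(1−s)) → 1` as `γ/(s(1−s)) → 0`, uniformly. -/
theorem stmt16
    (b : ℝ → ℝ → ℝ)
    (hb : ∀ s : ℝ, s ∈ Set.Ioo (0:ℝ) 1 → ∀ γ : ℝ, 0 < γ →
      b s γ ∈ Set.Ioo s 1 ∧ Kfun s (b s γ) = γ)
    (Hinv Htinv : ℝ → ℝ)
    (hHinv : ∀ y : ℝ, 0 ≤ y → 0 ≤ Hinv y ∧ Hfun (Hinv y) = y)
    (hHtinv : ∀ y : ℝ, 0 ≤ y → (0 ≤ Htinv y ∧ Htinv y < 1) ∧ Htfun (Htinv y) = y) :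
    (∀ s : ℝ, s ∈ Set.Ioo (0:ℝ) 1 → ∀ γ : ℝ, 0 < γ →
      b s γ - s ≤ s * Hinv (γ / s)) ∧
    (∀ s : ℝ, s ∈ Set.Ioo (0:ℝ) 1 → ∀ γ : ℝ, 0 < γ →
      s * (1 - s) * Htinv (γ / (1 - s)) ≤ b s γ - s ∧
      b s γ - s ≤ (1 - s) * Htinv (γ / (1 - s))) ∧
    (∀ ε : ℝ, 0 < ε → ∃ δ : ℝ, 0 < δ ∧
      ∀ s : ℝ, s ∈ Set.Ioo (0:ℝ) 1 → ∀ γ : ℝ, 0 < γ →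
        γ / (s * (1 - s)) ≤ δ →
        |(b s γ - s) / Real.sqrt (2 * γ * (s * (1 - s))) - 1| ≤ ε) := by
  have hxs : ∀ s : ℝ, s ∈ Set.Ioo (0:ℝ) 1 → ∀ γ : ℝ, 0 < γ →
      0 < b s γ - s ∧ b s γ - s < 1 - s ∧ Kfun s (s + (b s γ - s)) = γ := by
    intro s hs γ hγ
    obtain ⟨⟨h1, h2⟩, h3⟩ := hb s hs γ hγ
    exact ⟨by linarith, by linarith, by rwa [add_sub_cancel]⟩
  refine ⟨fun s hs γ hγ => ?_, fun s hs γ hγ => ?_, fun ε hε => ?_⟩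
  · obtain ⟨hx, hx1, hK⟩ := hxs s hs γ hγ
    have hs0 := hs.1
    obtain ⟨hz, hHz⟩ := hHinv (γ / s) (by positivity)
    rw [← div_le_iff₀' hs0, ← Hfun_strictMonoOn.le_iff_le (div_pos hx hs0).le hz, hHz,
      le_div_iff₀' hs0]
    exact (mul_Hfun_le_Kfun hs0 hx.le hx1).trans_eq hK
  · obtain ⟨hx, hx1, hK⟩ := hxs s hs γ hγ
    have hs0 := hs.1
    have hs1 : 0 < 1 - s := by linarith [hs.2]
    obtain ⟨hz, hHz⟩ := hHtinv (γ / (1 - s)) (by positivity)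
    constructor
    · have hv : 0 < s * (1 - s) := by positivity
      rw [← le_div_iff₀' hv]
      rcases le_or_gt 1 ((b s γ - s) / (s * (1 - s))) with h | h
      · exact hz.2.le.trans h
      · have hy := div_pos hx hv
        rw [← Htfun_strictMonoOn.le_iff_le hz ⟨hy.le, h⟩, hHz, div_le_iff₀' hs1]
        have hle := Kfun_le_mul_Htfun hs0 hs.2 hy.le h
        rwa [mul_div_cancel₀ _ hv.ne', hK] at hle
    · rw [← div_le_iff₀' hs1, ← Htfun_strictMonoOn.le_iff_le
        ⟨(div_pos hx hs1).le, (div_lt_one hs1).2 hx1⟩ hz, hHz, le_div_iff₀' hs1]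
      exact (mul_Htfun_le_Kfun hs0 hx.le hx1).trans_eq hK
  · refine ⟨ε ^ 2 / (2 * (1 + ε)), by positivity, fun s hs γ hγ hδ => ?_⟩
    obtain ⟨hx, hx1, hK⟩ := hxs s hs γ hγ
    have hv : 0 < s * (1 - s) := mul_pos hs.1 (by linarith [hs.2])
    have hup := sq_le_mul_Kfun hs.1 hx.le hx1
    have hlo := mul_Kfun_le_sq hs.1 hx.le hx1
    rw [hK] at hup hlo
    exact (abs_div_sqrt_sub_one_le hv hγ hx.le hlo hup).trans
      (div_le_of_sq_le hv hx.le hε hup hδ)
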